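/- Let a ∈ ℝ and β, η, ν > 0 with η² < 2βν. Let h : ℝ → ℝ be bounded, nonnegative, non-decreasing on [a, c) and non-increasing on (c, ∞) for some c with a ≤ c ≤ ∞, and suppose the limit λ = lim_{x→∞} H(x)/x² exists and is finite. Suppose there exists x₁* ∈ [0, μ) such that W(x₁*) = max_{x₁ ∈ [0, μ]} W(x₁). Then the function f* given on [a, ∞) by f*(x) = η − ν(x − a) for a ≤ x ≤ x₁* + a; f*(x) = η − νx₁* − ν·((μ − x₁*)²/(σ − 2μx₁* + x₁*²))·(x − a − x₁*) for x₁* + a ≤ x ≤ (σ − μx₁*)/(μ − x₁*) + a; and f*(x) = 0 for x ≥ (σ − μx₁*)/(μ − x₁*) + a, is feasible for the worst-case tail problem with parameters (a, β, η, ν) and attains its optimal value. -/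

import Mathlib

open MeasureTheory Set Filter Topology

/-- The right derivative of `f` at `x`: the derivative within `(x, ∞)`. -/
noncomputable def rightDeriv (f : ℝ → ℝ) (x : ℝ) : ℝ := derivWithin f (Set.Ioi x) x

/-- The right derivative of `f` exists at `x`. -/
def HasRightDerivAt (f : ℝ → ℝ) (x : ℝ) : Prop := ∃ d : ℝ, HasDerivWithinAt f d (Set.Ioi x) x

/-- `f` is feasible for the worst-case tail problem with parameters `(a, β, η, ν)`. -/
def Feasible (a β η ν : ℝ) (f : ℝ → ℝ) : Prop :=
  IntegrableOn f (Set.Ioi a) ∧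
  (∫ x in Set.Ioi a, f x) = β ∧
  f a = η ∧
  ContinuousWithinAt f (Set.Ici a) a ∧
  HasRightDerivAt f a ∧
  -ν ≤ rightDeriv f a ∧
  ConvexOn ℝ (Set.Ici a) f ∧
  (∀ x, a ≤ x → 0 ≤ f x)

/-- `H(x) = ∫₀ˣ ∫₀ᵘ h(v + a) dv du`. -/
noncomputable def Hfun (a : ℝ) (h : ℝ → ℝ) (x : ℝ) : ℝ :=
  ∫ u in (0:ℝ)..x, (∫ v in (0:ℝ)..u, h (v + a))

/-- The line-search objective `W(x₁)` (with `W(μ) = ν(H(μ) + λ(σ − μ²))`). -/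
noncomputable def Wfun (a ν μ σ lam : ℝ) (h : ℝ → ℝ) (x₁ : ℝ) : ℝ :=
  if x₁ = μ then ν * (Hfun a h μ + lam * (σ - μ ^ 2))
  else ν * ((σ - μ ^ 2) / (σ - 2 * μ * x₁ + x₁ ^ 2) * Hfun a h x₁ +
    (μ - x₁) ^ 2 / (σ - 2 * μ * x₁ + x₁ ^ 2) * Hfun a h ((σ - μ * x₁) / (μ - x₁)))


/-- Primitive. -/
noncomputable def Pk (k : ℝ → ℝ) (x : ℝ) : ℝ := ∫ v in (0:ℝ)..x, k v
/-- Double primitive. -/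
noncomputable def Hk (k : ℝ → ℝ) (x : ℝ) : ℝ := ∫ u in (0:ℝ)..x, Pk k u

lemma Pk_sub {k : ℝ → ℝ} (hk : ∀ a b, IntervalIntegrable k volume a b) (s t : ℝ) :
    Pk k t - Pk k s = ∫ x in s..t, k x :=
  intervalIntegral.integral_interval_sub_left (hk _ _) (hk _ _)

lemma Pk_cont {k : ℝ → ℝ} (hk : ∀ a b, IntervalIntegrable k volume a b) : Continuous (Pk k) :=
  intervalIntegral.continuous_primitive hk 0

lemma Hk_deriv {k : ℝ → ℝ} (hk : ∀ a b, IntervalIntegrable k volume a b) (x : ℝ) :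
    HasDerivAt (Hk k) (Pk k x) x :=
  intervalIntegral.integral_hasDerivAt_right ((Pk_cont hk).intervalIntegrable _ _)
    ((Pk_cont hk).stronglyMeasurableAtFilter _ _) (Pk_cont hk).continuousAt

lemma hinge {k : ℝ → ℝ} (hk : ∀ a b, IntervalIntegrable k volume a b) (s t : ℝ) :
    ∫ x in s..t, (t - x) * k x = Hk k t - Hk k s - (t - s) * Pk k s := by
  have hac : AbsolutelyContinuousOnInterval (fun x => ∫ v in s..x, k v) s t :=
    (hk s t).absolutelyContinuousOnInterval_intervalIntegral (by simp)
  have hlin : AbsolutelyContinuousOnInterval (fun x : ℝ => t - x) s t := by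
    apply ContDiffOn.absolutelyContinuousOnInterval
    fun_prop
  have h1 := hlin.integral_mul_deriv_eq_deriv_mul hac
  have h2 : ∫ x in s..t, (t - x) * deriv (fun x => ∫ v in s..x, k v) x
      = ∫ x in s..t, (t - x) * k x := by
    apply intervalIntegral.integral_congr_ae
    filter_upwards [(hk s t).ae_hasDerivAt_integral] with x hx hxm
    rw [(hx (uIoc_subset_uIcc hxm) s (by simp)).deriv]
  rw [h2] at h1
  rw [h1]
  have h3 : ∀ x : ℝ, deriv (fun x : ℝ => t - x) x = -1 := by
    intro x; simp
  simp only [h3, sub_self, zero_mul, intervalIntegral.integral_same, mul_zero, zero_sub,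
    neg_one_mul]
  rw [intervalIntegral.integral_neg]
  have h4 : ∫ x in s..t, (∫ v in s..x, k v) = ∫ x in s..t, (Pk k x - Pk k s) := by
    congr 1; ext x; rw [Pk_sub hk]
  rw [h4, intervalIntegral.integral_sub ((Pk_cont hk).intervalIntegrable _ _)
    (by simp)]
  have h5 : Hk k t - Hk k s = ∫ x in s..t, Pk k x :=
    intervalIntegral.integral_interval_sub_left ((Pk_cont hk).intervalIntegrable _ _)
      ((Pk_cont hk).intervalIntegrable _ _)
  rw [h5]
  simp

lemma telescope {φ g : ℝ → ℝ} {T C : ℝ} (hT : 0 < T)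
    (hφ : ∀ s t, 0 ≤ s → s ≤ t → t ≤ T → -(C * (t - s) * (g t - g s)) ≤ φ t - φ s) :
    φ 0 ≤ φ T := by
  have key : ∀ n : ℕ, 0 < n → -(C * (T / n) * (g T - g 0)) ≤ φ T - φ 0 := by
    intro n hn
    have hn' : (0:ℝ) < n := by exact_mod_cast hn
    have hsum : ∀ m : ℕ, m ≤ n → -(C * (T / n) * (g (m * (T / n)) - g 0)) ≤ φ (m * (T / n)) - φ 0 := by
      intro m
      induction m with
      | zero => intro _; simp
      | succ m ih =>
        intro hm
        have h1 := ih (by omega)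
        have hTn : 0 < T / n := by positivity
        have h2 := hφ (m * (T / n)) ((m + 1 : ℕ) * (T / n)) (by positivity)
          (by push_cast; nlinarith) (by
            have : ((m + 1 : ℕ) : ℝ) ≤ n := by exact_mod_cast hm
            calc ((m + 1 : ℕ) : ℝ) * (T / n) ≤ n * (T / n) := by gcongr
              _ = T := by field_simp)
        have h3 : ((m + 1 : ℕ) : ℝ) * (T / n) - m * (T / n) = T / n := by push_cast; ring
        rw [h3] at h2
        linarith
    have := hsum n le_rfl
    have h3 : (n : ℝ) * (T / n) = T := by field_simp
    rwa [h3] at this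
  have hlim : Tendsto (fun n : ℕ => -(C * (T / n) * (g T - g 0))) atTop (𝓝 (-(C * 0 * (g T - g 0)))) := by
    have := tendsto_const_div_atTop_nhds_zero_nat T
    exact ((this.const_mul C).mul_const _).neg
  have : -(C * 0 * (g T - g 0)) ≤ φ T - φ 0 :=
    le_of_tendsto hlim (by filter_upwards [eventually_gt_atTop 0] with n hn using key n hn)
  simp at this
  exact this

lemma Pk_lip {k : ℝ → ℝ} {M : ℝ} (hM : ∀ x, |k x| ≤ M) (x : ℝ) : |Pk k x| ≤ M * |x| := by
  have := intervalIntegral.norm_integral_le_of_norm_le_const (a := 0) (b := x) (f := k) (C := M)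
    (fun y _ => by simpa using hM y)
  simpa [Pk] using this

/-- finite-horizon weak duality -/
lemma weak_fin {κ f g : ℝ → ℝ} {M A B T : ℝ} (hT : 0 < T)
    (hk : ∀ a b, IntervalIntegrable κ volume a b) (hM : ∀ x, |κ x| ≤ M)
    (hK : ∀ x, 0 ≤ x → 0 ≤ A + B * x + Hk κ x)
    (hκf : ∀ s t, 0 ≤ s → s ≤ t → IntervalIntegrable (fun x => κ x * f x) volume s t)
    (hg : ∀ s y, 0 ≤ s → 0 ≤ y → f s + g s * (y - s) ≤ f y) :
    (B + Pk κ T) * f T - (A + B * T + Hk κ T) * g T - B * f 0 + A * g 0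
      ≤ ∫ x in (0:ℝ)..T, κ x * f x := by
  have hM0 : 0 ≤ M := (abs_nonneg _).trans (hM 0)
  have gmono : ∀ s t, 0 ≤ s → s ≤ t → g s ≤ g t := by
    intro s t hs hst
    rcases hst.eq_or_lt with rfl | hlt
    · exact le_rfl
    have h1 := hg s t hs (hs.trans hst)
    have h2 := hg t s (hs.trans hst) hs
    nlinarith
  have main := telescope (φ := fun s => (∫ x in (0:ℝ)..s, κ x * f x) - (B + Pk κ s) * f s
      + (A + B * s + Hk κ s) * g s) (g := g) (T := T) (C := |B| + M * T + M * T) hT ?_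
  · simp [Pk, Hk] at main ⊢
    linarith
  intro s t hs hst htT
  have ht := hs.trans hst
  have e1 : (∫ x in (0:ℝ)..t, κ x * f x) - (∫ x in (0:ℝ)..s, κ x * f x) = ∫ x in s..t, κ x * f x :=
    intervalIntegral.integral_interval_sub_left (hκf _ _ le_rfl ht) (hκf _ _ le_rfl hs)
  have hi1 : IntervalIntegrable (fun x => (t - x) * κ x) volume s t :=
    (hk s t).continuousOn_mul (by fun_prop)
  have hi2 : IntervalIntegrable (fun x => f t * κ x - g t * ((t - x) * κ x)) volume s t :=
    ((hk s t).const_mul _).sub (hi1.const_mul _)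
  have e2 : ∫ x in s..t, (f t * κ x - g t * ((t - x) * κ x)) =
      f t * (Pk κ t - Pk κ s) - g t * (Hk κ t - Hk κ s - (t - s) * Pk κ s) := by
    rw [intervalIntegral.integral_sub ((hk s t).const_mul _) (hi1.const_mul _),
      intervalIntegral.integral_const_mul, intervalIntegral.integral_const_mul, hinge hk, Pk_sub hk]
  have e3 : |(∫ x in s..t, κ x * f x) - ∫ x in s..t, (f t * κ x - g t * ((t - x) * κ x))|
      ≤ M * ((t - s) * (g t - g s)) * (t - s) := by
    rw [← intervalIntegral.integral_sub (hκf s t hs hst) hi2]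
    have := intervalIntegral.norm_integral_le_of_norm_le_const (a := s) (b := t)
      (f := fun x => κ x * f x - (f t * κ x - g t * ((t - x) * κ x)))
      (C := M * ((t - s) * (g t - g s))) ?_
    · rwa [abs_of_nonneg (sub_nonneg.2 hst), Real.norm_eq_abs] at this
    intro x hx
    rw [uIoc_of_le hst] at hx
    have hx0 : 0 ≤ x := hs.trans hx.1.le
    have : κ x * f x - (f t * κ x - g t * ((t - x) * κ x)) =
      κ x * (f x - f t - g t * (x - t)) := by ring
    rw [this, norm_mul, Real.norm_eq_abs, Real.norm_eq_abs]
    have l1 := hg t x ht hx0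
    have l2 := hg x t hx0 ht
    have l3 := gmono s x hs hx.1.le
    have l4 := gmono x t hx0 hx.2
    apply mul_le_mul (hM x) _ (abs_nonneg _) hM0
    rw [abs_of_nonneg (by linarith)]
    have : (t - x) * (g t - g x) ≤ (t - s) * (g t - g s) :=
      mul_le_mul (by linarith [hx.1]) (by linarith) (by linarith) (by linarith)
    nlinarith
  have e4 := (abs_le.1 e3).1
  rw [e2] at e4
  have gst := gmono s t hs hst
  have f1 := hg t s ht hs
  have f2 := hg s t hs ht
  have hP : |B + Pk κ s| ≤ |B| + M * T := by
    refine (abs_add_le _ _).trans ?_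
    have := Pk_lip hM s
    rw [abs_of_nonneg hs] at this
    have : M * s ≤ M * T := by apply mul_le_mul_of_nonneg_left _ hM0; linarith
    linarith
  have e5 : |(B + Pk κ s) * (f s - f t + (t - s) * g t)| ≤ (|B| + M * T) * ((t - s) * (g t - g s)) := by
    rw [abs_mul]
    apply mul_le_mul hP _ (abs_nonneg _) (by positivity)
    rw [abs_of_nonneg (by linarith)]
    nlinarith
  have e6 := (abs_le.1 e5).1
  have e7 : 0 ≤ (A + B * s + Hk κ s) * (g t - g s) := mul_nonneg (hK s hs) (by linarith)
  have e8 : M * ((t - s) * (g t - g s)) * (t - s) ≤ M * ((t - s) * (g t - g s)) * T := by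
    apply mul_le_mul_of_nonneg_left (by linarith)
    have := sub_nonneg.2 hst; have := sub_nonneg.2 gst
    positivity

  nlinarith [e1, e4, e6, e7, e8]

lemma ii_of_bdd {k : ℝ → ℝ} {M : ℝ} (hm : AEStronglyMeasurable k volume) (hM : ∀ x, |k x| ≤ M)
    (a b : ℝ) : IntervalIntegrable k volume a b := by
  rw [intervalIntegrable_iff]
  exact Measure.integrableOn_of_bounded (M := M) (by simp) hm
    (Filter.Eventually.of_forall fun x => by simpa using hM x)

lemma not_int_of_ge {f : ℝ → ℝ} (hf : IntegrableOn f (Ioi 0)) {c N : ℝ} (hc : 0 < c) (hN : 0 ≤ N)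
    (h : ∀ y, N < y → c ≤ f y) : False := by
  have h1 : IntegrableOn f (Ioi N) := hf.mono_set (Ioi_subset_Ioi hN)
  have h2 : IntegrableOn (fun _ : ℝ => c) (Ioi N) := by
    refine Integrable.mono' h1 aestronglyMeasurable_const ?_
    filter_upwards [ae_restrict_mem measurableSet_Ioi] with y hy
    simpa [abs_of_pos hc] using h y hy
  rw [integrableOn_const_iff] at h2
  simp [hc.ne'] at h2

lemma subgrad {f : ℝ → ℝ} (hf : ConvexOn ℝ (Ici 0) f) {s y : ℝ} (hs : 0 < s) (hy : 0 ≤ y) :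
    f s + derivWithin f (Ioi s) s * (y - s) ≤ f y := by
  have hi : s ∈ interior (Ici (0:ℝ)) := by simpa using hs
  rcases lt_trichotomy s y with h | rfl | h
  · have := hf.rightDeriv_le_slope_of_mem_interior hi (y := y) (by simpa using hy) h
    rw [slope_def_field, le_div_iff₀ (by linarith)] at this
    linarith
  · simp
  · have h1 := hf.slope_le_leftDeriv_of_mem_interior (x := y) (y := s) (by simpa using hy) hi h
    have h2 := h1.trans (hf.leftDeriv_le_rightDeriv_of_mem_interior hi)
    rw [slope_def_field, div_le_iff₀ (by linarith)] at h2
    linarith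

/-- weak duality on the half line -/
lemma weak_inf {κ f : ℝ → ℝ} {M A B ν : ℝ}
    (hm : AEStronglyMeasurable κ volume) (hM : ∀ x, |κ x| ≤ M)
    (hK : ∀ x, 0 ≤ x → 0 ≤ A + B * x + Hk κ x)
    (hf : ConvexOn ℝ (Ici 0) f) (hf0 : ∀ x, 0 ≤ x → 0 ≤ f x)
    (hfi : IntegrableOn f (Ioi 0)) (hν : ∀ y, 0 ≤ y → f 0 - ν * y ≤ f y) :
    - B * f 0 - ν * A ≤ ∫ x in Ioi 0, κ x * f x := by
  have hM0 : 0 ≤ M := (abs_nonneg _).trans (hM 0)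
  have hκf : IntegrableOn (fun x => κ x * f x) (Ioi 0) :=
    hfi.bdd_mul (c := M) hm.restrict (Filter.Eventually.of_forall fun x => by simpa using hM x)
  set g : ℝ → ℝ := fun s => if s ≤ 0 then -ν else derivWithin f (Ioi s) s with hgdef
  have hg : ∀ s y, 0 ≤ s → 0 ≤ y → f s + g s * (y - s) ≤ f y := by
    intro s y hs hy
    rcases hs.eq_or_lt with rfl | hs
    · simp [hgdef]; linarith [hν y hy]
    · simpa [hgdef, not_le.2 hs] using subgrad hf hs hy
  have hg0 : ∀ s, 0 ≤ s → g s ≤ 0 := by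
    intro s hs
    by_contra! hc
    refine not_int_of_ge hfi hc (N := s + 1) (by linarith) fun y hy => ?_
    have h1 := hg s y hs (by linarith)
    have h2 := hf0 s hs
    nlinarith
  have anti : ∀ x y, 0 ≤ x → x ≤ y → f y ≤ f x := by
    intro x y hx hxy
    have h1 := hg y x (hx.trans hxy) hx
    have h2 := hg0 y (hx.trans hxy)
    nlinarith
  have hii : ∀ {φ : ℝ → ℝ}, IntegrableOn φ (Ioi 0) → ∀ s t, 0 ≤ s → s ≤ t →
      IntervalIntegrable φ volume s t := by
    intro φ hφ s t hs hst
    rw [intervalIntegrable_iff_integrableOn_Ioc_of_le hst]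
    exact hφ.mono_set (fun x hx => lt_of_le_of_lt hs hx.1)
  -- limit of T f(2T)
  have lim1 : Tendsto (fun T : ℝ => ∫ x in (0:ℝ)..T, f x) atTop (𝓝 (∫ x in Ioi 0, f x)) :=
    intervalIntegral_tendsto_integral_Ioi 0 hfi tendsto_id
  have h2T : Tendsto (fun T : ℝ => 2 * T) atTop atTop :=
    tendsto_id.const_mul_atTop (by norm_num)
  have lim2 := (lim1.comp h2T).sub lim1
  rw [sub_self] at lim2
  have lim3 : Tendsto (fun T : ℝ => ∫ x in (0:ℝ)..(2 * T), κ x * f x) atTop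
      (𝓝 (∫ x in Ioi 0, κ x * f x)) :=
    intervalIntegral_tendsto_integral_Ioi 0 hκf h2T
  have lim4 : Tendsto (fun T : ℝ => (∫ x in (0:ℝ)..(2 * T), κ x * f x) + (|B| + 2 * M) *
      (((fun T : ℝ => ∫ x in (0:ℝ)..T, f x) ∘ fun T => 2 * T) T - ∫ x in (0:ℝ)..T, f x)) atTop
      (𝓝 ((∫ x in Ioi 0, κ x * f x) + (|B| + 2 * M) * 0)) := lim3.add (lim2.const_mul _)
  rw [mul_zero, add_zero] at lim4
  refine ge_of_tendsto lim4 ?_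
  filter_upwards [eventually_ge_atTop 1] with T hT
  have hw := weak_fin (T := 2 * T) (by linarith) (ii_of_bdd hm hM) hM hK (hii hκf) hg
  have hT0 : 0 ≤ 2 * T := by linarith
  have a1 : 0 ≤ -((A + B * (2 * T) + Hk κ (2 * T)) * g (2 * T)) := by
    have := mul_nonneg (hK _ hT0) (neg_nonneg.2 (hg0 _ hT0)); linarith
  have a2 : T * f (2 * T) ≤ (∫ x in (0:ℝ)..(2*T), f x) - ∫ x in (0:ℝ)..T, f x := by
    rw [intervalIntegral.integral_interval_sub_left (hii hfi _ _ le_rfl hT0)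
      (hii hfi _ _ le_rfl (by linarith))]
    have := intervalIntegral.integral_mono_on (a := T) (b := 2 * T) (f := fun _ => f (2 * T))
      (g := f) (μ := volume) (by linarith) (by simp) (hii hfi _ _ (by linarith) (by linarith))
      (fun x hx => anti x _ (by linarith [hx.1]) hx.2)
    simp at this
    linarith
  have hfT := hf0 _ hT0
  have a3 : -(|B| + M * (2 * T)) * f (2 * T) ≤ (B + Pk κ (2 * T)) * f (2 * T) := by
    apply mul_le_mul_of_nonneg_right _ hfT
    have := Pk_lip hM (2 * T)
    rw [abs_of_nonneg hT0] at this
    have := (abs_le.1 this).1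
    have := neg_abs_le B
    linarith
  have a4 : (|B| + M * (2 * T)) * f (2 * T) ≤ (|B| + 2 * M) * (T * f (2 * T)) := by
    have : 0 ≤ |B| * f (2 * T) * (T - 1) := by
      have : 0 ≤ T - 1 := by linarith
      positivity
    nlinarith
  have a5 : (|B| + 2 * M) * (T * f (2 * T)) ≤ (|B| + 2 * M) *
      ((∫ x in (0:ℝ)..(2*T), f x) - ∫ x in (0:ℝ)..T, f x) :=
    mul_le_mul_of_nonneg_left a2 (by positivity)
  have a6 : g 0 = -ν := by simp [hgdef]
  rw [a6] at hw
  simp only [Function.comp]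
  linarith

/-- Weak duality: a quadratic majorant of `H` bounds the objective. -/
lemma weak_dual {k f : ℝ → ℝ} {M A B C ν β : ℝ}
    (hm : AEStronglyMeasurable k volume) (hM : ∀ x, |k x| ≤ M)
    (hK : ∀ x, 0 ≤ x → Hk k x ≤ A + B * x + C * x ^ 2)
    (hf : ConvexOn ℝ (Ici 0) f) (hf0 : ∀ x, 0 ≤ x → 0 ≤ f x)
    (hfi : IntegrableOn f (Ioi 0)) (hβ : ∫ x in Ioi 0, f x = β)
    (hν : ∀ y, 0 ≤ y → f 0 - ν * y ≤ f y) :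
    ∫ x in Ioi 0, k x * f x ≤ A * ν + B * f 0 + 2 * C * β := by
  have hkf : IntegrableOn (fun x => k x * f x) (Ioi 0) :=
    hfi.bdd_mul (c := M) hm.restrict (Filter.Eventually.of_forall fun x => by simpa using hM x)
  have hk := ii_of_bdd hm hM
  have hP : ∀ x, Pk (fun y => 2 * C - k y) x = 2 * C * x - Pk k x := by
    intro x
    unfold Pk
    rw [intervalIntegral.integral_sub (by simp) (hk _ _)]
    simp; ring
  have hH : ∀ x, Hk (fun y => 2 * C - k y) x = C * x ^ 2 - Hk k x := by
    intro x
    have : Hk (fun y => 2 * C - k y) x = ∫ u in (0:ℝ)..x, (2 * C * u - Pk k u) := by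
      unfold Hk; simp_rw [hP]
    rw [this, intervalIntegral.integral_sub
      (Continuous.intervalIntegrable (by fun_prop) _ _) ((Pk_cont hk).intervalIntegrable _ _),
      intervalIntegral.integral_const_mul, integral_id]
    unfold Hk; ring
  have := weak_inf (κ := fun y => 2 * C - k y) (M := |2 * C| + M) (A := A) (B := B) (ν := ν)
    (f := f) (aestronglyMeasurable_const.sub hm)
    (fun x => (abs_sub _ _).trans (by linarith [hM x])) (fun x hx => by
      rw [hH]; linarith [hK x hx]) hf hf0 hfi hν
  have e : ∫ x in Ioi 0, (2 * C - k x) * f x = 2 * C * β - ∫ x in Ioi 0, k x * f x := by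
    simp_rw [sub_mul]
    rw [integral_sub (hfi.const_mul _) hkf, integral_const_mul, hβ]
  rw [e] at this
  linarith

lemma mvt_pos {G ψ : ℝ → ℝ} (hG : ∀ x, HasDerivAt G (ψ x) x) {a b : ℝ} (hab : a < b)
    (h : G a < G b) : ∃ u, a < u ∧ u < b ∧ 0 < ψ u := by
  obtain ⟨u, hu, he⟩ := exists_hasDerivAt_eq_slope G ψ hab
    (fun x _ => (hG x).continuousAt.continuousWithinAt) (fun x _ => hG x)
  exact ⟨u, hu.1, hu.2, by rw [he]; exact div_pos (by linarith) (by linarith)⟩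

lemma mvt_neg {G ψ : ℝ → ℝ} (hG : ∀ x, HasDerivAt G (ψ x) x) {a b : ℝ} (hab : a < b)
    (h : G b < G a) : ∃ u, a < u ∧ u < b ∧ ψ u < 0 := by
  obtain ⟨u, hu, he⟩ := exists_hasDerivAt_eq_slope G ψ hab
    (fun x _ => (hG x).continuousAt.continuousWithinAt) (fun x _ => hG x)
  exact ⟨u, hu.1, hu.2, by rw [he]; exact div_neg_of_neg_of_pos (by linarith) (by linarith)⟩

/-- Sign analysis: `G ≤ 0` on the half line. -/
lemma sign_lemma {G ψ : ℝ → ℝ} (hG : ∀ x, HasDerivAt G (ψ x) x) {μ σ x1 x2 : ℝ}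
    (hσ : μ ^ 2 < σ) (hx1 : 0 ≤ x1) (hx1μ : x1 < μ) (hx2 : x2 = (σ - μ * x1) / (μ - x1))
    (hQ : ∀ N, 0 ≤ N → ∃ c, 0 ≤ c ∧ c ≤ N ∧ ConvexOn ℝ (Icc 0 c) ψ ∧ ConcaveOn ℝ (Icc c N) ψ)
    (hΓ : ∀ y, 0 ≤ y → y < μ →
      (σ - μ ^ 2) * G y + (μ - y) ^ 2 * G ((σ - μ * y) / (μ - y)) ≤ 0)
    (g1 : G x1 = 0) (g2 : G x2 = 0) (p1 : ψ x1 ≤ 0) (p1' : 0 < x1 → ψ x1 = 0) (p2 : ψ x2 = 0)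
    (m : ℝ) (hm : 0 ≤ m) : G m ≤ 0 := by
  have hd : 0 < μ - x1 := by linarith
  have hμx2 : μ < x2 := by
    rw [hx2, lt_div_iff₀ hd]; nlinarith
  have hx12 : x1 < x2 := hx1μ.trans hμx2
  by_contra! hGm
  obtain ⟨c, hc0, hcN, hcvx, hccv⟩ := hQ (max m x2) (hm.trans (le_max_left _ _))
  have hN2 : x2 ≤ max m x2 := le_max_right _ _
  have hNm : m ≤ max m x2 := le_max_left _ _
  have cv : ∀ x y z, 0 ≤ x → x ≤ y → y ≤ z → z ≤ c → ψ y ≤ max (ψ x) (ψ z) := by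
    intro x y z h0 hxy hyz hz
    exact hcvx.le_max_of_mem_Icc ⟨h0, by linarith⟩ ⟨by linarith, hz⟩ ⟨hxy, hyz⟩
  have cc : ∀ x y z, c ≤ x → x ≤ y → y ≤ z → z ≤ max m x2 → min (ψ x) (ψ z) ≤ ψ y := by
    intro x y z h0 hxy hyz hz
    exact hccv.min_le_of_mem_Icc ⟨h0, by linarith⟩ ⟨by linarith, hz⟩ ⟨hxy, hyz⟩
  have hm1 : m ≠ x1 := by rintro rfl; linarith
  have hm2 : m ≠ x2 := by rintro rfl; linarith
  rcases lt_or_gt_of_ne hm1 with h1 | h1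
  · -- m < x1
    have hx1p : 0 < x1 := by linarith
    have q1 := p1' hx1p
    have hγ := hΓ m hm (by linarith)
    set z := (σ - μ * m) / (μ - m) with hz
    have hdm : 0 < μ - m := by linarith
    have hμz : μ < z := by rw [hz, lt_div_iff₀ hdm]; nlinarith
    have hzx2 : z < x2 := by
      rw [hz, hx2, div_lt_div_iff₀ hdm hd]; nlinarith
    have hGz : G z < 0 := by
      by_contra! hcon
      have : 0 < (σ - μ ^ 2) * G m := mul_pos (by linarith) hGm
      have : 0 ≤ (μ - m) ^ 2 * G z := by positivity
      linarith
    obtain ⟨u, hu1, hu2, hu⟩ := mvt_neg hG h1 (by linarith)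
    obtain ⟨v, hv1, hv2, hv⟩ := mvt_neg hG (a := x1) (b := z) (by linarith) (by linarith)
    obtain ⟨w, hw1, hw2, hw⟩ := mvt_pos hG hzx2 (by linarith)
    by_cases hvc : v ≤ c
    · have := cv u x1 v (by linarith) hu2.le hv1.le hvc
      rcases le_max_iff.1 this with h | h <;> linarith
    push Not at hvc
    have hcc := cc
    by_cases hcx : c ≤ x1
    · have := cc x1 v w hcx hv1.le (by linarith) (by linarith)
      rcases min_le_iff.1 this with h | h <;> linarith
    push Not at hcx
    have r1 : ψ c < 0 := by
      have := cc c v w le_rfl hvc.le (by linarith) (by linarith)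
      rcases min_le_iff.1 this with h | h <;> linarith
    have := cv u x1 c (by linarith) hu2.le hcx.le le_rfl
    rcases le_max_iff.1 this with h | h <;> linarith
  rcases lt_or_gt_of_ne hm2 with h2 | h2
  · -- between
    obtain ⟨u, hu1, hu2, hu⟩ := mvt_pos hG h1 (by linarith)
    obtain ⟨v, hv1, hv2, hv⟩ := mvt_neg hG h2 (by linarith)
    by_cases hvc : v ≤ c
    · have := cv x1 u v hx1 hu1.le (by linarith) hvc
      rcases le_max_iff.1 this with h | h <;> linarith
    push Not at hvc
    by_cases huc : c ≤ u
    · have := cc u v x2 huc (by linarith) hv2.le hN2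
      rcases min_le_iff.1 this with h | h <;> linarith
    push Not at huc
    have r1 : 0 < ψ c := by
      have := cv x1 u c hx1 hu1.le huc.le le_rfl
      rcases le_max_iff.1 this with h | h <;> linarith
    have := cc c v x2 le_rfl hvc.le hv2.le hN2
    rcases min_le_iff.1 this with h | h <;> linarith
  · -- m > x2
    have hmμ : 0 < m - μ := by linarith
    set y := μ - (σ - μ ^ 2) / (m - μ) with hy
    have hyμ : y < μ := by
      have : 0 < (σ - μ ^ 2) / (m - μ) := div_pos (by linarith) hmμ
      linarith
    have hyx1 : x1 < y := by
      have e : x2 - μ = (σ - μ ^ 2) / (μ - x1) := by rw [hx2]; field_simp; ring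
      have : (σ - μ ^ 2) / (m - μ) < μ - x1 := by
        rw [div_lt_iff₀ hmμ]
        have h3 : (σ - μ ^ 2) / (μ - x1) < m - μ := by linarith
        rw [div_lt_iff₀ hd] at h3
        linarith
      linarith
    have hzy : (σ - μ * y) / (μ - y) = m := by
      have hne : m - μ ≠ 0 := hmμ.ne'
      have h4 : μ - y = (σ - μ ^ 2) / (m - μ) := by rw [hy]; ring
      rw [div_eq_iff (by linarith), h4, hy]
      field_simp
      ring
    have hγ := hΓ y (by linarith) hyμ
    rw [hzy] at hγ
    have hGy : G y < 0 := by
      have : 0 < (μ - y) ^ 2 * G m := by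
        have : 0 < μ - y := by linarith
        positivity
      by_contra! hcon
      have := mul_nonneg (show 0 ≤ σ - μ ^ 2 by linarith) hcon
      linarith
    obtain ⟨u, hu1, hu2, hu⟩ := mvt_neg hG hyx1 (by linarith)
    obtain ⟨v, hv1, hv2, hv⟩ := mvt_pos hG (a := y) (b := x2) (by linarith) (by linarith)
    obtain ⟨w, hw1, hw2, hw⟩ := mvt_pos hG h2 (by linarith)
    by_cases hcx : x2 ≤ c
    · have := cv u v x2 (by linarith) (by linarith) hv2.le hcx
      rcases le_max_iff.1 this with h | h <;> linarith
    push Not at hcx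
    by_cases hvc : c ≤ v
    · have := cc v x2 w hvc hv2.le hw1.le (by linarith)
      rcases min_le_iff.1 this with h | h <;> linarith
    push Not at hvc
    have r1 : 0 < ψ c := by
      have := cv u v c (by linarith) (by linarith) hvc.le le_rfl
      rcases le_max_iff.1 this with h | h <;> linarith
    have := cc c x2 w le_rfl hcx.le hw1.le (by linarith)
    rcases min_le_iff.1 this with h | h <;> linarith

lemma majorant {k : ℝ → ℝ} (hk : ∀ a b, IntervalIntegrable k volume a b) {μ σ x1 x2 : ℝ}
    (hσ : μ ^ 2 < σ) (hx1 : 0 ≤ x1) (hx1μ : x1 < μ) (hx2 : x2 = (σ - μ * x1) / (μ - x1))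
    (hQ : ∀ N, 0 ≤ N → ∃ c, 0 ≤ c ∧ c ≤ N ∧ ConvexOn ℝ (Icc 0 c) (Pk k) ∧
      ConcaveOn ℝ (Icc c N) (Pk k))
    (hopt : ∀ y, 0 ≤ y → y < μ →
      (σ - μ ^ 2) / (σ - 2 * μ * y + y ^ 2) * Hk k y +
        (μ - y) ^ 2 / (σ - 2 * μ * y + y ^ 2) * Hk k ((σ - μ * y) / (μ - y)) ≤
      (σ - μ ^ 2) / (σ - 2 * μ * x1 + x1 ^ 2) * Hk k x1 +
        (μ - x1) ^ 2 / (σ - 2 * μ * x1 + x1 ^ 2) * Hk k x2) :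
    ∃ A B C, (∀ x, 0 ≤ x → Hk k x ≤ A + B * x + C * x ^ 2) ∧
      A + B * μ + C * σ = (σ - μ ^ 2) / (σ - 2 * μ * x1 + x1 ^ 2) * Hk k x1 +
        (μ - x1) ^ 2 / (σ - 2 * μ * x1 + x1 ^ 2) * Hk k x2 := by
  have hd : 0 < μ - x1 := by linarith
  have hμx2 : μ < x2 := by
    rw [hx2, lt_div_iff₀ hd]; nlinarith
  have hx12 : x1 < x2 := hx1μ.trans hμx2
  have hD : ∀ y, 0 < σ - 2 * μ * y + y ^ 2 := fun y => by nlinarith [sq_nonneg (μ - y)]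
  obtain ⟨C, hC⟩ : ∃ C, C * (x1 - x2) ^ 2 = Hk k x1 - Hk k x2 - Pk k x2 * (x1 - x2) :=
    ⟨(Hk k x1 - Hk k x2 - Pk k x2 * (x1 - x2)) / (x1 - x2) ^ 2, by
      rw [div_mul_cancel₀]; exact pow_ne_zero _ (by linarith)⟩
  obtain ⟨B, hB⟩ : ∃ B, B = Pk k x2 - 2 * C * x2 := ⟨_, rfl⟩
  obtain ⟨A, hA⟩ : ∃ A, A = Hk k x2 - Pk k x2 * x2 + C * x2 ^ 2 := ⟨_, rfl⟩
  have q1 : Hk k x1 = A + B * x1 + C * x1 ^ 2 := by rw [hA, hB]; linarith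
  have q2 : Hk k x2 = A + B * x2 + C * x2 ^ 2 := by rw [hA, hB]; ring
  have quad : ∀ y, y < μ → (σ - μ ^ 2) * (A + B * y + C * y ^ 2) + (μ - y) ^ 2 *
      (A + B * ((σ - μ * y) / (μ - y)) + C * ((σ - μ * y) / (μ - y)) ^ 2) =
      (σ - 2 * μ * y + y ^ 2) * (A + B * μ + C * σ) := by
    intro y hy
    have : μ - y ≠ 0 := by linarith
    field_simp
    ring
  have val : A + B * μ + C * σ = (σ - μ ^ 2) / (σ - 2 * μ * x1 + x1 ^ 2) * Hk k x1 +
        (μ - x1) ^ 2 / (σ - 2 * μ * x1 + x1 ^ 2) * Hk k x2 := by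
    have h1 := quad x1 hx1μ
    rw [← hx2, ← q1, ← q2] at h1
    rw [div_mul_eq_mul_div, div_mul_eq_mul_div, ← add_div, eq_div_iff (hD x1).ne']
    linarith
  refine ⟨A, B, C, ?_, val⟩
  set G : ℝ → ℝ := fun x => Hk k x - (A + B * x + C * x ^ 2) with hGdef
  set ψ : ℝ → ℝ := fun x => Pk k x - (B + 2 * C * x) with hψdef
  have hG : ∀ x, HasDerivAt G (ψ x) x := by
    intro x
    have h1 : HasDerivAt (fun x : ℝ => A + B * x + C * x ^ 2) (B + 2 * C * x) x := by
      have := (((hasDerivAt_id x).const_mul B).const_add A).add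
        (((hasDerivAt_id x).pow 2).const_mul C)
      exact this.congr_deriv (by simp; ring)
    exact (Hk_deriv hk x).sub h1
  have g1 : G x1 = 0 := by simp only [hGdef]; linarith
  have g2 : G x2 = 0 := by simp only [hGdef]; linarith
  have p2 : ψ x2 = 0 := by simp only [hψdef]; rw [hB]; ring
  have hΓ : ∀ y, 0 ≤ y → y < μ →
      (σ - μ ^ 2) * G y + (μ - y) ^ 2 * G ((σ - μ * y) / (μ - y)) ≤ 0 := by
    intro y hy hyμ
    have h1 := hopt y hy hyμ
    rw [← val] at h1
    have h2 : (σ - μ ^ 2) / (σ - 2 * μ * y + y ^ 2) * Hk k y +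
        (μ - y) ^ 2 / (σ - 2 * μ * y + y ^ 2) * Hk k ((σ - μ * y) / (μ - y)) =
        ((σ - μ ^ 2) * Hk k y + (μ - y) ^ 2 * Hk k ((σ - μ * y) / (μ - y))) /
          (σ - 2 * μ * y + y ^ 2) := by ring
    rw [h2, div_le_iff₀ (hD y)] at h1
    have h3 := quad y hyμ
    simp only [hGdef]
    linarith
  -- derivative of Γ at x1
  have hΓd : HasDerivAt (fun y => (σ - μ ^ 2) * G y + (μ - y) ^ 2 * G ((σ - μ * y) / (μ - y)))
      ((σ - μ ^ 2) * ψ x1) x1 := by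
    have hn : HasDerivAt (fun y : ℝ => σ - μ * y) (-(μ * 1)) x1 :=
      ((hasDerivAt_id x1).const_mul μ).const_sub σ
    have hdn : HasDerivAt (fun y : ℝ => μ - y) (-1) x1 := (hasDerivAt_id x1).const_sub μ
    have hz := hn.div hdn hd.ne'
    have hGz := HasDerivAt.comp x1 (h₂ := G) (h := fun y : ℝ => (σ - μ * y) / (μ - y))
      (h₂' := ψ x2) (by rw [← hx2]; exact hG x2) hz
    have h3 := ((hG x1).const_mul (σ - μ ^ 2)).add ((hdn.pow 2).mul hGz)
    refine h3.congr_deriv ?_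
    simp only [Function.comp, ← hx2, g2, p2]
    ring
  have hΓ1 : (σ - μ ^ 2) * G x1 + (μ - x1) ^ 2 * G ((σ - μ * x1) / (μ - x1)) = 0 := by
    rw [← hx2, g1, g2]; ring
  have hs : 0 < σ - μ ^ 2 := by linarith
  have p1 : ψ x1 ≤ 0 := by
    have h1 := (hasDerivWithinAt_iff_tendsto_slope' self_notMem_Ioi).mp
      (hΓd.hasDerivWithinAt (s := Ioi x1))
    have h2 : (σ - μ ^ 2) * ψ x1 ≤ 0 := by
      refine le_of_tendsto h1 ?_
      filter_upwards [Ioo_mem_nhdsGT hx1μ] with y hy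
      rw [slope_def_field, hΓ1]
      apply div_nonpos_of_nonpos_of_nonneg _ (by linarith [hy.1])
      linarith [hΓ y (by linarith [hy.1]) hy.2]
    by_contra! hcon
    have := mul_pos hs hcon
    linarith
  have p1' : 0 < x1 → ψ x1 = 0 := by
    intro hp
    have hl : IsLocalMax (fun y => (σ - μ ^ 2) * G y +
        (μ - y) ^ 2 * G ((σ - μ * y) / (μ - y))) x1 := by
      filter_upwards [Ioo_mem_nhds hp hx1μ] with y hy
      rw [hΓ1]
      exact hΓ y hy.1.le hy.2
    have := hl.hasDerivAt_eq_zero hΓd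
    rcases mul_eq_zero.1 this with h | h
    · linarith
    · exact h
  intro m hm
  have hlin1 : ∀ s : Set ℝ, Convex ℝ s → ConcaveOn ℝ s (fun x => B + 2 * C * x) := by
    intro s hs
    refine ⟨hs, fun x _ y _ a b _ _ hab => ?_⟩
    simp only [smul_eq_mul]
    have : b = 1 - a := by linarith
    subst this
    apply le_of_eq; ring
  have hlin2 : ∀ s : Set ℝ, Convex ℝ s → ConvexOn ℝ s (fun x => B + 2 * C * x) := by
    intro s hs
    refine ⟨hs, fun x _ y _ a b _ _ hab => ?_⟩
    simp only [smul_eq_mul]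
    have : b = 1 - a := by linarith
    subst this
    apply le_of_eq; ring
  have := sign_lemma hG hσ hx1 hx1μ hx2 (fun N hN => by
    obtain ⟨c, h1, h2, h3, h4⟩ := hQ N hN
    exact ⟨c, h1, h2, h3.sub (hlin1 _ (convex_Icc _ _)), h4.sub (hlin2 _ (convex_Icc _ _))⟩)
    hΓ g1 g2 p1 p1' p2 m hm
  simp only [hGdef] at this
  linarith

lemma Pk_convex {k : ℝ → ℝ} (hk : ∀ a b, IntervalIntegrable k volume a b) {p q : ℝ}
    (hmono : MonotoneOn k (Ioo p q)) : ConvexOn ℝ (Icc p q) (Pk k) := by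
  refine convexOn_of_slope_mono_adjacent (convex_Icc _ _) ?_
  intro x y z hx hz hxy hyz
  have hy : y ∈ Ioo p q := ⟨hx.1.trans_lt hxy, hyz.trans_le hz.2⟩
  rw [Pk_sub hk, Pk_sub hk]
  have h1 : ∫ t in x..y, k t ≤ ∫ t in x..y, k y :=
    intervalIntegral.integral_mono_on_of_le_Ioo hxy.le (hk _ _) (by simp) fun t ht =>
      hmono ⟨hx.1.trans_lt ht.1, ht.2.trans hy.2⟩ hy ht.2.le
  have h2 : ∫ t in y..z, k y ≤ ∫ t in y..z, k t :=
    intervalIntegral.integral_mono_on_of_le_Ioo hyz.le (by simp) (hk _ _) fun t ht =>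
      hmono hy ⟨hy.1.trans ht.1, ht.2.trans_le hz.2⟩ ht.1.le
  simp at h1 h2
  calc _ ≤ k y := by rw [div_le_iff₀ (by linarith)]; linarith
    _ ≤ _ := by rw [le_div_iff₀ (by linarith)]; linarith

lemma Pk_concave {k : ℝ → ℝ} (hk : ∀ a b, IntervalIntegrable k volume a b) {p q : ℝ}
    (hanti : AntitoneOn k (Ioo p q)) : ConcaveOn ℝ (Icc p q) (Pk k) := by
  have h1 := Pk_convex (k := fun x => - k x) (fun a b => (hk a b).neg) hanti.neg
  have h2 : Pk (fun x => - k x) = - Pk k := by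
    ext x; simp [Pk]
  rw [h2] at h1
  simpa using h1.neg

lemma unimodal_Q {k : ℝ → ℝ} (hk : ∀ a b, IntervalIntegrable k volume a b)
    (hU : MonotoneOn k (Ici 0) ∨ ∃ d, 0 ≤ d ∧ MonotoneOn k (Ico 0 d) ∧ AntitoneOn k (Ioi d))
    (N : ℝ) (hN : 0 ≤ N) : ∃ c, 0 ≤ c ∧ c ≤ N ∧ ConvexOn ℝ (Icc 0 c) (Pk k) ∧
      ConcaveOn ℝ (Icc c N) (Pk k) := by
  rcases hU with h | ⟨d, hd, h1, h2⟩
  · exact ⟨N, hN, le_rfl, Pk_convex hk (h.mono fun x hx => hx.1.le),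
      Pk_concave hk (fun x hx => by simp at hx)⟩
  · refine ⟨min d N, le_min hd hN, min_le_right _ _, Pk_convex hk (h1.mono fun x hx =>
      ⟨hx.1.le, hx.2.trans_le (min_le_left _ _)⟩), Pk_concave hk (h2.mono fun x hx => ?_)⟩
    rcases min_lt_iff.1 hx.1 with h | h
    · exact h
    · exact absurd hx.2 (not_lt.2 h.le)

lemma unimodal_meas {k : ℝ → ℝ} (h0 : ∀ x, x < 0 → k x = 0)
    (hU : MonotoneOn k (Ici 0) ∨ ∃ d, 0 ≤ d ∧ MonotoneOn k (Ico 0 d) ∧ AntitoneOn k (Ioi d)) :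
    AEStronglyMeasurable k volume := by
  have hneg : AEMeasurable k (volume.restrict (Iio 0)) := by
    refine aemeasurable_restrict_of_monotoneOn measurableSet_Iio fun x hx y hy _ => ?_
    rw [h0 x hx, h0 y hy]
  have hIci : AEMeasurable k (volume.restrict (Ici 0)) := by
    rcases hU with h | ⟨d, hd, h1, h2⟩
    · exact aemeasurable_restrict_of_monotoneOn measurableSet_Ici h
    · have e : Ici (0:ℝ) = (Ico 0 d ∪ Icc d d) ∪ Ioi d := by
        rw [Ico_union_Icc_eq_Icc hd le_rfl, Icc_union_Ioi_eq_Ici hd]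
      rw [e, aemeasurable_union_iff, aemeasurable_union_iff]
      refine ⟨⟨aemeasurable_restrict_of_monotoneOn measurableSet_Ico h1, ?_⟩,
        aemeasurable_restrict_of_antitoneOn measurableSet_Ioi h2⟩
      refine aemeasurable_restrict_of_monotoneOn measurableSet_Icc fun x hx y hy _ => ?_
      have : x = y := by rw [Icc_self] at hx hy; rw [hx, hy]
      rw [this]
  have : AEMeasurable k (volume.restrict (Iio 0 ∪ Ici 0)) := aemeasurable_union_iff.2 ⟨hneg, hIci⟩
  rw [Iio_union_Ici, Measure.restrict_univ] at this
  exact this.aestronglyMeasurable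

lemma hinge_int {k : ℝ → ℝ} (hk : ∀ a b, IntervalIntegrable k volume a b) {t : ℝ} (ht : 0 ≤ t) :
    IntegrableOn (fun x => k x * max (t - x) 0) (Ioi 0) ∧
      ∫ x in Ioi 0, k x * max (t - x) 0 = Hk k t := by
  have hz : ∀ x ∈ Ioi (0:ℝ) \ Ioc 0 t, k x * max (t - x) 0 = 0 := by
    intro x hx
    have : t < x := by
      by_contra! hc
      exact hx.2 ⟨hx.1, hc⟩
    rw [max_eq_right (by linarith), mul_zero]
  have hi : IntervalIntegrable (fun x => k x * max (t - x) 0) volume 0 t :=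
    (hk 0 t).mul_continuousOn (by fun_prop)
  refine ⟨IntegrableOn.of_forall_sdiff_eq_zero
    ((intervalIntegrable_iff_integrableOn_Ioc_of_le ht).1 hi) measurableSet_Ioi hz, ?_⟩
  rw [setIntegral_eq_of_subset_of_forall_sdiff_eq_zero measurableSet_Ioi
    (fun x hx => hx.1) hz, ← intervalIntegral.integral_of_le ht]
  have := hinge hk 0 t
  simp [Hk, Pk] at this
  unfold Hk Pk
  rw [← this]
  apply intervalIntegral.integral_congr
  intro x hx
  rw [uIcc_of_le ht] at hx
  simp only
  rw [max_eq_left (by linarith [hx.2]), mul_comm]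

lemma Hk_one (t : ℝ) : Hk (fun _ => 1) t = t ^ 2 / 2 := by
  simp [Hk, Pk]

lemma shift_int (a : ℝ) (φ : ℝ → ℝ) : ∫ x in Ioi a, φ x = ∫ x in Ioi 0, φ (x + a) := by
  have := (measurePreserving_add_right volume a).setIntegral_preimage_emb
    (measurableEmbedding_addRight a) φ (Ioi a)
  rw [← this]
  simp

lemma shift_integrable (a : ℝ) (φ : ℝ → ℝ) :
    IntegrableOn φ (Ioi a) ↔ IntegrableOn (fun x => φ (x + a)) (Ioi 0) := by
  have := (measurePreserving_add_right volume a).integrableOn_comp_preimage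
    (measurableEmbedding_addRight a) (f := φ) (s := Ioi a)
  rw [← this]
  simp [Function.comp_def]
/-- Theorem: if the line search `max_{x₁ ∈ [0, μ]} W(x₁)` is attained at some
`x₁* ∈ [0, μ)`, then the explicit two-segment piecewise linear tail `f*` is feasible
and attains the optimal value of the worst-case tail problem. -/
theorem explicit_optimal_solution
    (a β η ν : ℝ) (hβ : 0 < β) (hη : 0 < η) (hν : 0 < ν)
    (hcond : η ^ 2 < 2 * β * ν)
    (h : ℝ → ℝ) (hbd : ∃ M, ∀ x, |h x| ≤ M) (hpos : ∀ x, 0 ≤ h x)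
    (hquasi : ∃ c : EReal, (a : EReal) ≤ c ∧
      MonotoneOn h {x : ℝ | a ≤ x ∧ (x : EReal) < c} ∧
      AntitoneOn h {x : ℝ | c < (x : EReal)})
    (lam : ℝ) (hlam : Tendsto (fun x => Hfun a h x / x ^ 2) atTop (𝓝 lam))
    (μ σ : ℝ) (hμ : μ = η / ν) (hσ : σ = 2 * β / ν)
    (x₁s : ℝ) (hx₁s : x₁s ∈ Set.Ico (0:ℝ) μ)
    (hmax : ∀ x₁ ∈ Set.Icc (0:ℝ) μ, Wfun a ν μ σ lam h x₁ ≤ Wfun a ν μ σ lam h x₁s) :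
    ∀ f : ℝ → ℝ,
      (∀ x, a ≤ x → x ≤ x₁s + a → f x = η - ν * (x - a)) →
      (∀ x, x₁s + a ≤ x → x ≤ (σ - μ * x₁s) / (μ - x₁s) + a →
        f x = η - ν * x₁s -
          ν * ((μ - x₁s) ^ 2 / (σ - 2 * μ * x₁s + x₁s ^ 2)) * (x - a - x₁s)) →
      (∀ x, (σ - μ * x₁s) / (μ - x₁s) + a ≤ x → f x = 0) →
      Feasible a β η ν f ∧
        (∫ x in Set.Ioi a, h x * f x) =
          sSup {z : ℝ | ∃ g : ℝ → ℝ, Feasible a β η ν g ∧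
            z = ∫ x in Set.Ioi a, h x * g x} := by

  obtain ⟨M, hM⟩ := hbd
  obtain ⟨hx0, hxμ⟩ := hx₁s
  have hημ : η = ν * μ := by rw [hμ]; field_simp
  have hβσ : β = ν * σ / 2 := by rw [hσ]; field_simp
  have hμσ : μ ^ 2 < σ := by
    rw [hημ, hβσ] at hcond
    have h1 : ν ^ 2 * μ ^ 2 < ν ^ 2 * σ := by nlinarith
    exact lt_of_mul_lt_mul_left h1 (by positivity)
  set k : ℝ → ℝ := (Ici 0).indicator (fun v => h (v + a)) with hkdef
  have k0 : ∀ x, x < 0 → k x = 0 := fun x hx => by simp [hkdef, hx]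
  have k1 : ∀ x, 0 ≤ x → k x = h (x + a) := fun x hx => by simp [hkdef, hx]
  have kM : ∀ x, |k x| ≤ M := by
    intro x
    rcases lt_or_ge x 0 with hx | hx
    · rw [k0 x hx, abs_zero]; exact (abs_nonneg _).trans (hM 0)
    · rw [k1 x hx]; exact hM _
  have hU : MonotoneOn k (Ici 0) ∨
      ∃ d, 0 ≤ d ∧ MonotoneOn k (Ico 0 d) ∧ AntitoneOn k (Ioi d) := by
    obtain ⟨c, hac, hm, ha⟩ := hquasi
    induction c with
    | bot => simp at hac
    | top =>
      left
      intro x hx y hy hxy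
      simp only [mem_Ici] at hx hy
      rw [k1 x hx, k1 y hy]
      exact hm ⟨by linarith, EReal.coe_lt_top _⟩ ⟨by linarith, EReal.coe_lt_top _⟩ (by linarith)
    | coe c =>
      right
      have hac' : a ≤ c := by exact_mod_cast hac
      refine ⟨c - a, by linarith, ?_, ?_⟩
      · intro x hx y hy hxy
        rw [k1 x hx.1, k1 y hy.1]
        exact hm ⟨by linarith [hx.1], EReal.coe_lt_coe_iff.2 (by linarith [hx.2])⟩
          ⟨by linarith [hy.1], EReal.coe_lt_coe_iff.2 (by linarith [hy.2])⟩ (by linarith)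
      · intro x hx y hy hxy
        simp only [mem_Ioi] at hx hy
        rw [k1 x (by linarith), k1 y (by linarith)]
        exact ha (EReal.coe_lt_coe_iff.2 (by linarith))
          (EReal.coe_lt_coe_iff.2 (by linarith)) (by linarith)
  have km := unimodal_meas k0 hU
  have hk := ii_of_bdd km kM
  have HH : ∀ x, 0 ≤ x → Hfun a h x = Hk k x := by
    intro x hx
    unfold Hfun Hk Pk
    refine intervalIntegral.integral_congr fun u hu => ?_
    rw [uIcc_of_le hx] at hu
    refine intervalIntegral.integral_congr fun v hv => ?_
    rw [uIcc_of_le hu.1] at hv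
    exact (k1 v hv.1).symm
  have hzpos : ∀ y, 0 ≤ y → y < μ → μ < (σ - μ * y) / (μ - y) := by
    intro y hy hyμ
    rw [lt_div_iff₀ (by linarith)]; nlinarith
  set x2 := (σ - μ * x₁s) / (μ - x₁s) with hx2
  have hμx2 : μ < x2 := hzpos _ hx0 hxμ
  have hD : 0 < σ - 2 * μ * x₁s + x₁s ^ 2 := by nlinarith [sq_nonneg (μ - x₁s)]
  set D := σ - 2 * μ * x₁s + x₁s ^ 2 with hDdef
  have hopt : ∀ y, 0 ≤ y → y < μ →
      (σ - μ ^ 2) / (σ - 2 * μ * y + y ^ 2) * Hk k y +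
        (μ - y) ^ 2 / (σ - 2 * μ * y + y ^ 2) * Hk k ((σ - μ * y) / (μ - y)) ≤
      (σ - μ ^ 2) / D * Hk k x₁s + (μ - x₁s) ^ 2 / D * Hk k x2 := by
    intro y hy hyμ
    have h1 := hmax y ⟨hy, hyμ.le⟩
    unfold Wfun at h1
    rw [if_neg hyμ.ne, if_neg hxμ.ne, HH y hy, HH x₁s hx0,
      HH _ (by linarith [hzpos y hy hyμ]), HH _ (by linarith)] at h1
    exact le_of_mul_le_mul_left h1 hν
  obtain ⟨A, B, C, hmaj, hval⟩ := majorant hk hμσ hx0 hxμ hx2 (unimodal_Q hk hU) hopt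
  intro f hf1 hf2 hf3
  obtain ⟨w1, hw1⟩ : ∃ w, w = (σ - μ ^ 2) / D := ⟨_, rfl⟩
  obtain ⟨w2, hw2⟩ : ∃ w, w = (μ - x₁s) ^ 2 / D := ⟨_, rfl⟩
  have hw1p : 0 ≤ w1 := by rw [hw1]; exact div_nonneg (by linarith) hD.le
  have hw2p : 0 ≤ w2 := by rw [hw2]; positivity
  rw [← hw1, ← hw2] at hval
  rw [← hw2] at hf2
  have hd : μ - x₁s ≠ 0 := by linarith
  have hws : w1 + w2 = 1 := by
    rw [hw1, hw2, ← add_div, div_eq_one_iff_eq hD.ne', hDdef]; ring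
  have hwx : w2 * (x2 - x₁s) = μ - x₁s := by
    have : x2 - x₁s = D / (μ - x₁s) := by rw [hx2, hDdef]; field_simp; ring
    rw [this, hw2]; field_simp
  have hwx2 : w1 * x₁s ^ 2 + w2 * x2 ^ 2 = σ := by
    have h1 : w1 = 1 - w2 := by linarith
    have h2 : (μ - x₁s) * x2 = σ - μ * x₁s := by rw [hx2]; field_simp
    have h3 : w1 * x₁s ^ 2 + w2 * x2 ^ 2 = x₁s ^ 2 + (w2 * (x2 - x₁s)) * (x2 + x₁s) := by
      rw [h1]; ring
    rw [h3, hwx]; linarith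
  have hF : ∀ x, 0 ≤ x → f (x + a) = ν * (w1 * max (x₁s - x) 0 + w2 * max (x2 - x) 0) := by
    intro x hx
    rcases le_total x x₁s with h1 | h1
    · rw [hf1 _ (by linarith) (by linarith), max_eq_left (by linarith), max_eq_left (by linarith),
        hημ]
      have : w1 = 1 - w2 := by linarith
      rw [this]
      linear_combination -ν * hwx
    rcases le_total x x2 with h2 | h2
    · rw [hf2 _ (by linarith) (by linarith), max_eq_right (by linarith), max_eq_left (by linarith),
        hημ]
      linear_combination -ν * hwx
    · rw [hf3 _ (by linarith), max_eq_right (by linarith), max_eq_right (by linarith)]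
      ring
  -- integrals of `q * f` for a weight `q`
  have hint : ∀ q : ℝ → ℝ, (∀ a b, IntervalIntegrable q volume a b) →
      IntegrableOn (fun x => q x * f (x + a)) (Ioi 0) ∧
      ∫ x in Ioi 0, q x * f (x + a) = ν * (w1 * Hk q x₁s + w2 * Hk q x2) := by
    intro q hq
    obtain ⟨i1, e1⟩ := hinge_int hq hx0
    obtain ⟨i2, e2⟩ := hinge_int hq (t := x2) (by linarith)
    have hc : EqOn (fun x => q x * f (x + a)) (fun x => (ν * w1) * (q x * max (x₁s - x) 0) +
        (ν * w2) * (q x * max (x2 - x) 0)) (Ioi 0) := by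
      intro x hx
      simp only
      rw [hF x (le_of_lt hx)]; ring
    constructor
    · rw [integrableOn_congr_fun hc measurableSet_Ioi]
      exact (i1.const_mul _).add (i2.const_mul _)
    · rw [setIntegral_congr_fun measurableSet_Ioi hc, integral_add (i1.const_mul _)
        (i2.const_mul _), integral_const_mul, integral_const_mul, e1, e2]
      ring
  have hone := hint (fun _ => 1) (by simp)
  simp only [one_mul, Hk_one] at hone
  have hshift : ∀ g : ℝ → ℝ, ∫ x in Ioi a, h x * g x = ∫ x in Ioi 0, k x * g (x + a) := by
    intro g
    rw [shift_int]
    refine setIntegral_congr_fun measurableSet_Ioi fun x hx => ?_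
    rw [k1 x (le_of_lt hx)]
  have hfa : f a = η := by rw [hf1 a le_rfl (by linarith)]; ring
  -- the function agrees with an affine function to the right of `a`
  obtain ⟨m, e, hm, he, hfe⟩ : ∃ m e : ℝ, m ≤ ν ∧ a < e ∧ ∀ x, a ≤ x → x ≤ e →
      f x = η - m * (x - a) := by
    rcases hx0.eq_or_lt with h0 | h0
    · refine ⟨ν * w2, x2 + a, ?_, by linarith, fun x hx hxe => ?_⟩
      · have : w2 ≤ 1 := by linarith
        nlinarith
      · rw [hf2 x (by linarith) hxe, ← h0]; ring
    · exact ⟨ν, x₁s + a, le_rfl, by linarith, hf1⟩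
  have hder : HasDerivWithinAt f (-m) (Ici a) a := by
    have h1 : HasDerivWithinAt (fun x => η - m * (x - a)) (-m) (Ici a) a := by
      have := (((hasDerivAt_id a).sub_const a).const_mul m).const_sub η
      exact (this.congr_deriv (by simp)).hasDerivWithinAt
    refine h1.congr_of_eventuallyEq ?_ (hfe a le_rfl he.le)
    filter_upwards [Icc_mem_nhdsGE he] with x hx
    exact hfe x hx.1 hx.2
  have hcvx : ConvexOn ℝ (Ici a) f := by
    have hmx : ∀ t : ℝ, ConvexOn ℝ (Ici a) (fun x => max (t - (x - a)) 0) := by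
      intro t
      have hl : ConvexOn ℝ (Ici a) (fun x : ℝ => t - (x - a)) := by
        refine ⟨convex_Ici a, fun x _ y _ p q _ _ hpq => ?_⟩
        simp only [smul_eq_mul]
        have : q = 1 - p := by linarith
        subst this
        apply le_of_eq; ring
      exact hl.sup (convexOn_const 0 (convex_Ici a))
    have h1 := (((hmx x₁s).smul hw1p).add ((hmx x2).smul hw2p)).smul hν.le
    refine h1.congr fun x hx => ?_
    have := hF (x - a) (sub_nonneg.2 hx)
    rw [sub_add_cancel] at this
    rw [this]
    simp
  have hfeas : Feasible a β η ν f := by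
    refine ⟨?_, ?_, hfa, hder.continuousWithinAt, ⟨-m, hder.mono Ioi_subset_Ici_self⟩, ?_, hcvx, ?_⟩
    · rw [shift_integrable]; exact hone.1
    · rw [shift_int, hone.2, hβσ]
      linear_combination ν / 2 * hwx2
    · unfold rightDeriv
      rw [(hder.mono Ioi_subset_Ici_self).derivWithin (uniqueDiffWithinAt_Ioi a)]
      linarith
    · intro x hx
      have := hF (x - a) (sub_nonneg.2 hx)
      rw [sub_add_cancel] at this
      rw [this]
      positivity
  refine ⟨hfeas, ?_⟩
  have hgr : IsGreatest {z : ℝ | ∃ g : ℝ → ℝ, Feasible a β η ν g ∧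
      z = ∫ x in Set.Ioi a, h x * g x} (∫ x in Set.Ioi a, h x * f x) := by
    refine ⟨⟨f, hfeas, rfl⟩, ?_⟩
    rintro z ⟨g, ⟨gi, gβ, ga, -, ⟨d, gd⟩, gν, gc, g0⟩, rfl⟩
    have hdν : -ν ≤ d := by
      unfold rightDeriv at gν
      rwa [gd.derivWithin (uniqueDiffWithinAt_Ioi a)] at gν
    have gc' : ConvexOn ℝ (Ici 0) (fun x => g (x + a)) := by
      have := gc.translate_left a
      simpa [Function.comp_def] using this
    rw [hshift g, hshift f, (hint k hk).2]
    have hwd := weak_dual (f := fun x => g (x + a)) (ν := ν) (β := β) km kM hmaj gc'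
      (fun x hx => g0 _ (by linarith)) ((shift_integrable a g).1 gi)
      (by rw [← shift_int]; exact gβ) (by
        intro y hy
        simp only [zero_add]
        rcases hy.eq_or_lt with rfl | hy
        · simp
        have := gc.le_slope_of_hasDerivWithinAt_Ioi (x := a) (y := y + a) (by simp)
          (by simpa using hy.le) (by linarith) gd
        rw [slope_def_field, le_div_iff₀ (by linarith)] at this
        have h2 : -ν * y ≤ d * y := mul_le_mul_of_nonneg_right hdν hy.le
        have h3 : d * (y + a - a) = d * y := by ring
        linarith)
    simp only [zero_add, ga] at hwd
    refine hwd.trans (le_of_eq ?_)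
    rw [← hval, hημ, hβσ]
    ring
  exact hgr.csSup_eq.symm
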